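/- arXiv:2212.08569 — 2 statements merged into one kernel-verified Lean document; each statement's English description precedes it below -/
import Mathlib

section
/- Assume: (i) |T(t₂,x) − T(t₁,x)| ≤ C(x t₂^{1/4} + √t₂ + √t₂/x) for all 0 < t₁ ≤ t₂ ≤ t₀ and all x > 0, so that for each x > 0 the limit T(0,x) := lim_{t→0⁺} T(t,x) exists; (ii) |T(0,x) − T(0,y)| ≤ M|x − y| for all x, y > 0; (iii) there exist a sequence t_n → 0⁺ of positive times and a map T* : (0,∞) → ℝ³ with lim_{n→∞} T(t_n, x√t_n) = T*(x) for every x > 0; (iv) there exist A ∈ ℝ³ and C' > 0 with |T*(x) − A| ≤ C'/x for all x > 0. Then lim_{x→0⁺} T(0,x) = A. -/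
open MeasureTheory Real Filter Set Topology

noncomputable section

abbrev R3 := EuclideanSpace ℝ (Fin 3)

/-- identification of the trace of the tangent vector at `x → 0⁺` via
self-similar paths `x√tₙ`. -/
theorem tangent_trace_at_origin_via_selfsimilar_paths
    (t₀ C M : ℝ) (ht₀ : 0 < t₀) (ht₀' : t₀ ≤ 1) (hC : 0 < C) (hM : 0 < M)
    (T : ℝ → ℝ → R3) (T₀ : ℝ → R3)
    (hCauchy : ∀ t₁ t₂ : ℝ, 0 < t₁ → t₁ ≤ t₂ → t₂ ≤ t₀ → ∀ x : ℝ, 0 < x →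
      ‖T t₂ x - T t₁ x‖ ≤ C * (x * t₂ ^ (1 / 4 : ℝ) + Real.sqrt t₂ + Real.sqrt t₂ / x))
    (hlim : ∀ x : ℝ, 0 < x → Tendsto (fun t => T t x) (𝓝[>] (0 : ℝ)) (𝓝 (T₀ x)))
    (hLip : ∀ x : ℝ, 0 < x → ∀ y : ℝ, 0 < y → ‖T₀ x - T₀ y‖ ≤ M * |x - y|)
    (tn : ℕ → ℝ) (htn : ∀ n, 0 < tn n ∧ tn n ≤ t₀) (htn0 : Tendsto tn atTop (𝓝 0))
    (Tstar : ℝ → R3)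
    (hTstar : ∀ x : ℝ, 0 < x →
      Tendsto (fun n => T (tn n) (x * Real.sqrt (tn n))) atTop (𝓝 (Tstar x)))
    (A : R3) (C' : ℝ) (hC' : 0 < C')
    (hA : ∀ x : ℝ, 0 < x → ‖Tstar x - A‖ ≤ C' / x) :
    Tendsto T₀ (𝓝[>] (0 : ℝ)) (𝓝 A) := by
  have key : ∀ y : ℝ, 0 < y → ∀ X : ℝ, 0 < X → ‖T₀ y - A‖ ≤ M * y + (C + C') / X := by
    intro y hy X hX
    have hs : Tendsto (fun n => Real.sqrt (tn n)) atTop (𝓝 0) := by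
      simpa using htn0.sqrt
    have hq : Tendsto (fun n => (tn n) ^ (1 / 4 : ℝ)) atTop (𝓝 0) := by
      have h := htn0.rpow_const (p := (1 / 4 : ℝ)) (Or.inr (by norm_num))
      rwa [Real.zero_rpow (by norm_num)] at h
    have hT : Tendsto (fun n => ‖T (tn n) (X * Real.sqrt (tn n)) - Tstar X‖) atTop (𝓝 0) := by
      have h := ((hTstar X hX).sub_const (Tstar X)).norm
      rwa [sub_self, norm_zero] at h
    have hbound : ∀ n, ‖T₀ y - A‖ ≤ M * |y - X * Real.sqrt (tn n)|
        + C * (X * Real.sqrt (tn n) * (tn n) ^ (1 / 4 : ℝ) + Real.sqrt (tn n) + 1 / X)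
        + ‖T (tn n) (X * Real.sqrt (tn n)) - Tstar X‖ + C' / X := by
      intro n
      obtain ⟨hp, hle⟩ := htn n
      have hsp : 0 < Real.sqrt (tn n) := Real.sqrt_pos.2 hp
      have hx : 0 < X * Real.sqrt (tn n) := mul_pos hX hsp
      have h1 := hLip y hy _ hx
      have h2 : ‖T (tn n) (X * Real.sqrt (tn n)) - T₀ (X * Real.sqrt (tn n))‖ ≤
          C * (X * Real.sqrt (tn n) * (tn n) ^ (1 / 4 : ℝ) + Real.sqrt (tn n) + 1 / X) := by
        have hl := ((hlim _ hx).const_sub (T (tn n) (X * Real.sqrt (tn n)))).norm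
        refine le_of_tendsto hl ?_
        filter_upwards [Ioc_mem_nhdsGT hp] with t ht
        have h := hCauchy t (tn n) ht.1 ht.2 hle _ hx
        have e : Real.sqrt (tn n) / (X * Real.sqrt (tn n)) = 1 / X := by
          field_simp
        rwa [e] at h
      have h3 := hA X hX
      have e : T₀ y - A = (T₀ y - T₀ (X * Real.sqrt (tn n)))
          - (T (tn n) (X * Real.sqrt (tn n)) - T₀ (X * Real.sqrt (tn n)))
          + (T (tn n) (X * Real.sqrt (tn n)) - Tstar X) + (Tstar X - A) := by abel
      rw [e]
      refine (norm_add_le _ _).trans (add_le_add ((norm_add_le _ _).trans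
        (add_le_add ((norm_sub_le _ _).trans (add_le_add h1 h2)) le_rfl)) h3)
    have hlimit := ((((((hs.const_mul X).const_sub y).abs).const_mul M).add
      (((((hs.const_mul X).mul hq).add hs).add_const (1 / X)).const_mul C)).add hT).add_const
        (C' / X)
    have h := ge_of_tendsto' hlimit hbound
    have e : |y - X * 0| = y := by rw [mul_zero, sub_zero, abs_of_pos hy]
    rw [e] at h
    refine h.trans (le_of_eq ?_)
    ring
  have key2 : ∀ y : ℝ, 0 < y → ‖T₀ y - A‖ ≤ M * y := by
    intro y hy
    have hl : Tendsto (fun X : ℝ => M * y + (C + C') / X) atTop (𝓝 (M * y + 0)) :=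
      (tendsto_const_nhds.div_atTop tendsto_id).const_add _
    rw [add_zero] at hl
    refine ge_of_tendsto hl ?_
    filter_upwards [eventually_gt_atTop 0] with X hX using key y hy X hX
  rw [tendsto_iff_norm_sub_tendsto_zero]
  have hl : Tendsto (fun y : ℝ => M * y) (𝓝[>] (0 : ℝ)) (𝓝 0) := by
    have h : Tendsto (fun y : ℝ => M * y) (𝓝 0) (𝓝 (M * 0)) := tendsto_id.const_mul M
    rw [mul_zero] at h
    exact h.mono_left nhdsWithin_le_nhds
  refine squeeze_zero' (Eventually.of_forall fun _ => norm_nonneg _) ?_ hl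
  filter_upwards [self_mem_nhdsWithin] with y hy using key2 y hy
end
end

section
/- Assume: (i) |Ñ(t₂,x) − Ñ(t₁,x)| ≤ C(x t₂^{1/4} + √t₂ + √t₂/x + t₂/x²) for all 0 < t₁ ≤ t₂ ≤ t₀ and all x > 0, so that for each x > 0 the limit Ñ(0,x) := lim_{t→0⁺} Ñ(t,x) exists; (ii) |Ñ(0,x) − Ñ(0,y)| ≤ M|x − y| for all x, y > 0; (iii) there exist a sequence t_n → 0⁺ of positive times with e^{iα² log √t_n} = 1 for all n, and a map N* : (0,∞) → ℂ³ with lim_{n→∞} N(t_n, x√t_n) = N*(x) for every x > 0; (iv) there exist B ∈ ℂ³ and C' > 0 with |e^{iα² log x} N*(x) − B| ≤ C'/x for all x > 0. Then lim_{x→0⁺} Ñ(0,x) = B. -/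
open MeasureTheory Real Filter Set Topology

noncomputable section

abbrev C3 := EuclideanSpace ℂ (Fin 3)

/-- The modulated normal vector `Ñ(t,x) = e^{iα² log(x/√t)} N(t,x)` (for `x > 0`). -/
def modN (α : ℝ) (N : ℝ → ℝ → C3) (t x : ℝ) : C3 :=
  Complex.exp (Complex.I * (α : ℂ) ^ 2 * Real.log (x / Real.sqrt t)) • N t x

/-- identification of the trace of the modulated normal vector at `x → 0⁺`
via self-similar paths `x√tₙ` along times with trivial phase `e^{iα² log √tₙ} = 1`. -/
theorem normal_trace_at_origin_via_selfsimilar_paths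
    (α t₀ C M : ℝ) (hα : 0 < α) (ht₀ : 0 < t₀) (ht₀' : t₀ ≤ 1) (hC : 0 < C) (hM : 0 < M)
    (N : ℝ → ℝ → C3) (N₀ : ℝ → C3)
    (hCauchy : ∀ t₁ t₂ : ℝ, 0 < t₁ → t₁ ≤ t₂ → t₂ ≤ t₀ → ∀ x : ℝ, 0 < x →
      ‖modN α N t₂ x - modN α N t₁ x‖
        ≤ C * (x * t₂ ^ (1 / 4 : ℝ) + Real.sqrt t₂ + Real.sqrt t₂ / x + t₂ / x ^ 2))
    (hlim : ∀ x : ℝ, 0 < x → Tendsto (fun t => modN α N t x) (𝓝[>] (0 : ℝ)) (𝓝 (N₀ x)))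
    (hLip : ∀ x : ℝ, 0 < x → ∀ y : ℝ, 0 < y → ‖N₀ x - N₀ y‖ ≤ M * |x - y|)
    (tn : ℕ → ℝ) (htn : ∀ n, 0 < tn n ∧ tn n ≤ t₀) (htn0 : Tendsto tn atTop (𝓝 0))
    (htnphase : ∀ n, Complex.exp (Complex.I * (α : ℂ) ^ 2 * Real.log (Real.sqrt (tn n))) = 1)
    (Nstar : ℝ → C3)
    (hNstar : ∀ x : ℝ, 0 < x →
      Tendsto (fun n => N (tn n) (x * Real.sqrt (tn n))) atTop (𝓝 (Nstar x)))
    (B : C3) (C' : ℝ) (hC' : 0 < C')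
    (hB : ∀ x : ℝ, 0 < x →
      ‖Complex.exp (Complex.I * (α : ℂ) ^ 2 * Real.log x) • Nstar x - B‖ ≤ C' / x) :
    Tendsto N₀ (𝓝[>] (0 : ℝ)) (𝓝 B) := by
  have hs0 : Tendsto (fun n => Real.sqrt (tn n)) atTop (𝓝 0) := by
    have := (Real.continuous_sqrt.tendsto 0).comp htn0
    simpa [Function.comp_def] using this
  -- bound at time zero
  have hzero : ∀ t : ℝ, 0 < t → t ≤ t₀ → ∀ x : ℝ, 0 < x →
      ‖modN α N t x - N₀ x‖
        ≤ C * (x * t ^ (1 / 4 : ℝ) + Real.sqrt t + Real.sqrt t / x + t / x ^ 2) := by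
    intro t ht htt x hx
    have h1 : Tendsto (fun t₁ => ‖modN α N t x - modN α N t₁ x‖) (𝓝[>] (0 : ℝ))
        (𝓝 ‖modN α N t x - N₀ x‖) := (tendsto_const_nhds.sub (hlim x hx)).norm
    refine le_of_tendsto h1 ?_
    filter_upwards [Ioc_mem_nhdsGT ht] with t₁ h
    exact hCauchy t₁ t h.1 h.2 htt x hx
  have key : ∀ y : ℝ, 0 < y → ∀ x : ℝ, 0 < x →
      ‖N₀ y - B‖ ≤ M * y + C * (x⁻¹ + x⁻¹ ^ 2) + C' * x⁻¹ := by
    intro y hy x hx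
    set E : ℂ := Complex.exp (Complex.I * (α : ℂ) ^ 2 * Real.log x) with hE
    have hlimn : Tendsto (fun n => M * |y - x * Real.sqrt (tn n)|
        + C * (x * Real.sqrt (tn n) * (tn n) ^ (1 / 4 : ℝ) + Real.sqrt (tn n) + (x⁻¹ + x⁻¹ ^ 2))
        + ‖E • N (tn n) (x * Real.sqrt (tn n)) - E • Nstar x‖ + C' * x⁻¹) atTop
        (𝓝 (M * |y - x * 0| + C * (x * 0 * (0:ℝ) ^ (1 / 4 : ℝ) + 0 + (x⁻¹ + x⁻¹ ^ 2))
        + ‖E • Nstar x - E • Nstar x‖ + C' * x⁻¹)) := by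
      have hq : Tendsto (fun n => (tn n) ^ (1 / 4 : ℝ)) atTop (𝓝 ((0:ℝ) ^ (1 / 4 : ℝ))) :=
        htn0.rpow_const (Or.inr (by norm_num))
      have hxs := hs0.const_mul x
      refine Tendsto.add (Tendsto.add (Tendsto.add ?_ ?_) ?_) tendsto_const_nhds
      · exact ((tendsto_const_nhds.sub hxs).abs).const_mul M
      · exact (((hxs.mul hq).add hs0).add tendsto_const_nhds).const_mul C
      · exact (((hNstar x hx).const_smul E).sub tendsto_const_nhds).norm
    have hle := ge_of_tendsto' hlimn (b := ‖N₀ y - B‖) ?_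
    · simpa [abs_of_pos hy] using hle
    intro n
    obtain ⟨hp, hpt⟩ := htn n
    have hs : 0 < Real.sqrt (tn n) := Real.sqrt_pos.2 hp
    have hxs : 0 < x * Real.sqrt (tn n) := mul_pos hx hs
    have hmod : modN α N (tn n) (x * Real.sqrt (tn n))
        = E • N (tn n) (x * Real.sqrt (tn n)) := by
      rw [modN, mul_div_cancel_right₀ _ hs.ne']
    have h1 := hLip y hy _ hxs
    have h2 := hzero _ hp hpt _ hxs
    rw [hmod] at h2
    have e1 : Real.sqrt (tn n) / (x * Real.sqrt (tn n)) = x⁻¹ := by field_simp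
    have e2 : tn n / (x * Real.sqrt (tn n)) ^ 2 = x⁻¹ ^ 2 := by
      rw [mul_pow, Real.sq_sqrt hp.le]; field_simp
    rw [e1, e2] at h2
    have h3 := hB x hx
    rw [div_eq_mul_inv] at h3
    set P := E • N (tn n) (x * Real.sqrt (tn n))
    have t1 := norm_sub_le_norm_sub_add_norm_sub (N₀ y) (N₀ (x * Real.sqrt (tn n))) B
    have t2 := norm_sub_le_norm_sub_add_norm_sub (N₀ (x * Real.sqrt (tn n))) P B
    have t3 := norm_sub_le_norm_sub_add_norm_sub P (E • Nstar x) B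
    rw [norm_sub_rev _ P] at t2
    linarith
  have key2 : ∀ y : ℝ, 0 < y → ‖N₀ y - B‖ ≤ M * y := by
    intro y hy
    have hi : Tendsto (fun x : ℝ => x⁻¹) atTop (𝓝 0) := tendsto_inv_atTop_zero
    have hl : Tendsto (fun x : ℝ => M * y + C * (x⁻¹ + x⁻¹ ^ 2) + C' * x⁻¹) atTop
        (𝓝 (M * y + C * (0 + 0 ^ 2) + C' * 0)) :=
      (tendsto_const_nhds.add ((hi.add (hi.pow 2)).const_mul C)).add (hi.const_mul C')
    have := ge_of_tendsto hl (b := ‖N₀ y - B‖) (by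
      filter_upwards [eventually_gt_atTop 0] with x hx using key y hy x hx)
    simpa using this
  rw [tendsto_iff_norm_sub_tendsto_zero]
  have hMy : Tendsto (fun y : ℝ => M * y) (𝓝[>] (0 : ℝ)) (𝓝 0) := by
    have : Tendsto (fun y : ℝ => M * y) (𝓝 (0 : ℝ)) (𝓝 (M * 0)) := tendsto_id.const_mul M
    rw [mul_zero] at this
    exact this.mono_left nhdsWithin_le_nhds
  refine tendsto_of_tendsto_of_tendsto_of_le_of_le' tendsto_const_nhds hMy
    (Eventually.of_forall fun _ => norm_nonneg _) ?_
  filter_upwards [self_mem_nhdsWithin] with y hy using key2 y hy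
end
end
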